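/- Let R be a commutative ring, 𝒜 an R-linear category, and S a simple R-linear representation of 𝒜. Then: (3) for every object x of 𝒜, the evaluation S(x) is either a simple End_𝒜(x)-module or zero; and (4) if T is any simple R-linear representation of 𝒜 and x is an object with S(x) ≠ 0 and S(x) ≅ T(x) as End_𝒜(x)-modules, then S ≅ T. -/

import Mathlib

open CategoryTheory

universe t w v u

variable {R : Type w} [CommRing R]
variable {A : Type u} [Category.{v} A] [Preadditive A] [Linear R A]

/-- An `R`-linear representation of the `R`-linear category `A` is an additive `R`-linear
functor `A ⥤ ModuleCat R`. -/
def IsLinearRep (M : A ⥤ ModuleCat.{t} R) : Prop :=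
  ∃ _ : M.Additive, M.Linear R

/-- A subrepresentation of a representation `M : A ⥤ ModuleCat R`. -/
structure SubRep (M : A ⥤ ModuleCat.{t} R) where
  carrier : ∀ x : A, Submodule R (M.obj x)
  map_mem : ∀ {x y : A} (f : x ⟶ y), ∀ m ∈ carrier x, M.map f m ∈ carrier y

/-- A representation is simple if it is nonzero and its only subrepresentations are
`0` and itself. -/
def IsSimpleRep (M : A ⥤ ModuleCat.{t} R) : Prop :=
  (∃ (x : A) (m : M.obj x), m ≠ 0) ∧
    ∀ N : SubRep M, (∀ x : A, N.carrier x = ⊥) ∨ (∀ x : A, N.carrier x = ⊤)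

/-- The evaluation `M(x)` is a simple module over `End_𝒜(x)`: it is nonzero, and its only
submodules stable under the action of all endomorphisms of `x` are `⊥` and `⊤`. -/
def IsSimpleEval (M : A ⥤ ModuleCat.{t} R) (x : A) : Prop :=
  (∃ m : M.obj x, m ≠ 0) ∧
    ∀ p : Submodule R (M.obj x),
      (∀ f : x ⟶ x, ∀ m ∈ p, M.map f m ∈ p) → p = ⊥ ∨ p = ⊤

section Representations

set_option linter.unusedSectionVars false

namespace SubRep

variable {M N : A ⥤ ModuleCat.{t} R}

/-- The subrepresentation generated by a submodule of the evaluation at `x`. -/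
def generated (M : A ⥤ ModuleCat.{t} R) (x : A) (p : Submodule R (M.obj x)) : SubRep M where
  carrier y := ⨆ f : x ⟶ y, p.map (M.map f).hom
  map_mem {y z} g m hm := by
    suffices h : (⨆ f : x ⟶ y, p.map (M.map f).hom) ≤
        (⨆ f : x ⟶ z, p.map (M.map f).hom).comap (M.map g).hom from h hm
    refine iSup_le fun f => Submodule.map_le_iff_le_comap.2 fun a ha => ?_
    refine Submodule.mem_iSup_of_mem (f ≫ g) ⟨a, ha, ?_⟩
    simp

theorem generated_carrier_self (x : A) (p : Submodule R (M.obj x))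
    (hp : ∀ f : x ⟶ x, ∀ m ∈ p, M.map f m ∈ p) : (generated M x p).carrier x = p := by
  refine le_antisymm (iSup_le fun f => Submodule.map_le_iff_le_comap.2 (hp f)) fun m hm => ?_
  exact Submodule.mem_iSup_of_mem (𝟙 x) ⟨m, hm, by simp⟩

/-- The preimage of a subrepresentation under a morphism of representations. -/
def comap (φ : M ⟶ N) (P : SubRep N) : SubRep M where
  carrier x := (P.carrier x).comap (φ.app x).hom
  map_mem {x y} f m hm := by
    have h := P.map_mem f _ hm
    rwa [Submodule.mem_comap, NatTrans.naturality_apply φ f m]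

/-- The image of a subrepresentation under a morphism of representations. -/
def map (φ : M ⟶ N) (P : SubRep M) : SubRep N where
  carrier x := (P.carrier x).map (φ.app x).hom
  map_mem {x y} f := by
    rintro _ ⟨m, hm, rfl⟩
    exact ⟨_, P.map_mem f m hm, NatTrans.naturality_apply φ f m⟩

/-- A subrepresentation regarded as a representation. -/
def toFunctor (P : SubRep M) : A ⥤ ModuleCat.{t} R where
  obj x := ModuleCat.of R (P.carrier x)
  map {x y} f := ModuleCat.ofHom ((M.map f).hom.restrict (P.map_mem f))
  map_id x := by ext m; simp
  map_comp f g := by ext m; simp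

/-- The inclusion of a subrepresentation. -/
def subtype (P : SubRep M) : P.toFunctor ⟶ M where
  app x := ModuleCat.ofHom (P.carrier x).subtype
  naturality _ _ _ := rfl

end SubRep

theorem IsSimpleRep.carrier_eq_bot {S : A ⥤ ModuleCat.{t} R} (hS : IsSimpleRep S) (N : SubRep S)
    {x : A} (hx : N.carrier x ≠ ⊤) (y : A) : N.carrier y = ⊥ :=
  (hS.2 N).elim (fun h => h y) fun h => absurd (h x) hx

theorem IsSimpleRep.carrier_eq_top {S : A ⥤ ModuleCat.{t} R} (hS : IsSimpleRep S) (N : SubRep S)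
    {x : A} (hx : N.carrier x ≠ ⊥) (y : A) : N.carrier y = ⊤ :=
  (hS.2 N).elim (fun h => absurd (h x) hx) fun h => h y

theorem IsSimpleRep.isSimpleEval {S : A ⥤ ModuleCat.{t} R} (hS : IsSimpleRep S) {x : A}
    (hx : ∃ m : S.obj x, m ≠ 0) : IsSimpleEval S x := by
  refine ⟨hx, fun p hp => ?_⟩
  rw [← SubRep.generated_carrier_self x p hp]
  exact (hS.2 _).imp (fun h => h x) fun h => h x

/-- A morphism of representations that is bijective on every evaluation is an isomorphism. -/
theorem isIso_of_bijective_app {M N : A ⥤ ModuleCat.{t} R} (φ : M ⟶ N)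
    (h : ∀ x, Function.Bijective (φ.app x)) : IsIso φ :=
  have (x : A) : IsIso (φ.app x) := (ConcreteCategory.isIso_iff_bijective _).2 (h x)
  NatIso.isIso_of_isIso_app φ

section Product

variable (S T : A ⥤ ModuleCat.{t} R)

/-- The pointwise product of two representations. -/
def prodRep : A ⥤ ModuleCat.{t} R where
  obj x := ModuleCat.of R (S.obj x × T.obj x)
  map f := ModuleCat.ofHom ((S.map f).hom.prodMap (T.map f).hom)
  map_id x := by ext m <;> simp
  map_comp f g := by ext m <;> simp

/-- The first projection from the product representation. -/
def prodRepFst : prodRep S T ⟶ S where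
  app x := ModuleCat.ofHom (LinearMap.fst R (S.obj x) (T.obj x))
  naturality _ _ _ := rfl

/-- The second projection from the product representation. -/
def prodRepSnd : prodRep S T ⟶ T where
  app x := ModuleCat.ofHom (LinearMap.snd R (S.obj x) (T.obj x))
  naturality _ _ _ := rfl

/-- The first inclusion into the product representation. -/
def prodRepInl : S ⟶ prodRep S T where
  app x := ModuleCat.ofHom (LinearMap.inl R (S.obj x) (T.obj x))
  naturality x y f := by
    ext m
    exact Prod.ext rfl (map_zero (T.map f).hom).symm

/-- The second inclusion into the product representation. -/
def prodRepInr : T ⟶ prodRep S T where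
  app x := ModuleCat.ofHom (LinearMap.inr R (S.obj x) (T.obj x))
  naturality x y f := by
    ext m
    exact Prod.ext (map_zero (S.map f).hom).symm rfl

end Product

/-- Two simple representations are isomorphic if some subrepresentation of their product is,
at an object where they do not vanish, the graph of a linear equivalence. -/
theorem nonempty_iso_of_carrier_eq_graph {S T : A ⥤ ModuleCat.{t} R} (hS : IsSimpleRep S)
    (hT : IsSimpleRep T) {x : A} (hx : ∃ m : S.obj x, m ≠ 0) (e : S.obj x ≃ₗ[R] T.obj x)
    (G : SubRep (prodRep S T)) (hG : ∀ m : S.obj x × T.obj x, m ∈ G.carrier x ↔ m.2 = e m.1) :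
    Nonempty (S ≅ T) := by
  obtain ⟨a, ha⟩ := hx
  have hea : e a ≠ 0 := e.map_ne_zero_iff.2 ha
  have inl_eq_bot (y : A) : (G.comap (prodRepInl S T)).carrier y = ⊥ := by
    refine hS.carrier_eq_bot _ (x := x) (fun h => hea ?_) y
    exact ((hG (a, 0)).1 (h.ge (Submodule.mem_top (x := a)))).symm
  have inr_eq_bot (y : A) : (G.comap (prodRepInr S T)).carrier y = ⊥ := by
    refine hT.carrier_eq_bot _ (x := x) (fun h => hea ?_) y
    exact ((hG (0, e a)).1 (h.ge (Submodule.mem_top (x := e a)))).trans (map_zero e)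
  have fst_eq_top (y : A) : (G.map (prodRepFst S T)).carrier y = ⊤ := by
    refine hS.carrier_eq_top _ (x := x) (fun h => ha ?_) y
    exact h.le ⟨(a, e a), (hG _).2 rfl, rfl⟩
  have snd_eq_top (y : A) : (G.map (prodRepSnd S T)).carrier y = ⊤ := by
    refine hT.carrier_eq_top _ (x := x) (fun h => hea ?_) y
    exact h.le ⟨(a, e a), (hG _).2 rfl, rfl⟩
  have : IsIso (G.subtype ≫ prodRepFst S T) := by
    refine isIso_of_bijective_app _ fun y => ⟨?_, fun s => ?_⟩
    · refine (injective_iff_map_eq_zero ((G.subtype ≫ prodRepFst S T).app y).hom).2 ?_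
      rintro ⟨⟨s, t⟩, h⟩ (rfl : s = 0)
      obtain rfl : t = 0 := (inr_eq_bot y).le h
      rfl
    · obtain ⟨m, hm, rfl⟩ := (fst_eq_top y).ge (Submodule.mem_top (x := s))
      exact ⟨⟨m, hm⟩, rfl⟩
  have : IsIso (G.subtype ≫ prodRepSnd S T) := by
    refine isIso_of_bijective_app _ fun y => ⟨?_, fun t => ?_⟩
    · refine (injective_iff_map_eq_zero ((G.subtype ≫ prodRepSnd S T).app y).hom).2 ?_
      rintro ⟨⟨s, t⟩, h⟩ (rfl : t = 0)
      obtain rfl : s = 0 := (inl_eq_bot y).le h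
      rfl
    · obtain ⟨m, hm, rfl⟩ := (snd_eq_top y).ge (Submodule.mem_top (x := t))
      exact ⟨⟨m, hm⟩, rfl⟩
  exact ⟨(asIso (G.subtype ≫ prodRepFst S T)).symm ≪≫ asIso (G.subtype ≫ prodRepSnd S T)⟩

end Representations

/-- For a simple representation `S`: (3) every evaluation `S(x)` is a simple
`End_𝒜(x)`-module or zero; (4) if `T` is simple and `S(x) ≅ T(x) ≠ 0` as
`End_𝒜(x)`-modules, then `S ≅ T`. -/
theorem simple_evaluation (S : A ⥤ ModuleCat.{t} R)
    (hSl : IsLinearRep S) (hS : IsSimpleRep S) :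
    (∀ x : A, IsSimpleEval S x ∨ ∀ m : S.obj x, m = 0) ∧
    (∀ (T : A ⥤ ModuleCat.{t} R), IsLinearRep T → IsSimpleRep T →
      ∀ x : A, (∃ m : S.obj x, m ≠ 0) →
        (∃ e : S.obj x ≃ₗ[R] T.obj x,
          ∀ (f : x ⟶ x) (m : S.obj x), e (S.map f m) = T.map f (e m)) →
        Nonempty (S ≅ T)) := by
  refine ⟨fun x => ?_, fun T _ hT x hx ⟨e, he⟩ => ?_⟩
  · by_cases hx : ∃ m : S.obj x, m ≠ 0
    · exact .inl (hS.isSimpleEval hx)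
    · exact .inr (by simpa using hx)
  · let p : Submodule R ((prodRep S T).obj x) := e.toLinearMap.graph
    have hp : ∀ f : x ⟶ x, ∀ m ∈ p, (prodRep S T).map f m ∈ p := by
      rintro f ⟨s, t⟩ (rfl : t = e s)
      exact (he f s).symm
    refine nonempty_iso_of_carrier_eq_graph hS hT hx e (SubRep.generated _ x p) fun m => ?_
    rw [SubRep.generated_carrier_self x p hp]
    exact e.toLinearMap.mem_graph_iff m
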